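/- arXiv:2001.04875 — 4 statements merged into one kernel-verified Lean document; each statement's English description precedes it below -/
import Mathlib

section
/- Let A ∈ ℝ^{n×n} and let X ∈ ℝ^{n×n} be symmetric positive definite with AᵀXA − X negative definite. Then every complex eigenvalue λ of A satisfies |λ| < 1. -/
open Matrix

/-- A real matrix is negative definite iff its negation is positive definite. -/
def Matrix.NegDef {ι : Type*} [Fintype ι] (M : Matrix ι ι ℝ) : Prop := (-M).PosDef

theorem Matrix.exists_mulVec_eq_smul_of_mem_spectrum {ι K : Type*} [Fintype ι] [DecidableEq ι]
    [Field K] {M : Matrix ι ι K} {μ : K} (hμ : μ ∈ spectrum K M) :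
    ∃ v : ι → K, v ≠ 0 ∧ M *ᵥ v = μ • v := by
  rw [← Matrix.spectrum_toLin', ← Module.End.hasEigenvalue_iff_mem_spectrum] at hμ
  obtain ⟨v, hv⟩ := hμ.exists_hasEigenvector
  exact ⟨v, hv.2, by simpa using hv.apply_eq_smul⟩

theorem Matrix.re_map_mulVec {ι : Type*} [Fintype ι] (A : Matrix ι ι ℝ) (v : ι → ℂ) :
    (fun i => ((A.map (algebraMap ℝ ℂ) *ᵥ v) i).re) = A *ᵥ fun i => (v i).re := by
  ext i
  simp [mulVec, dotProduct]

theorem Matrix.im_map_mulVec {ι : Type*} [Fintype ι] (A : Matrix ι ι ℝ) (v : ι → ℂ) :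
    (fun i => ((A.map (algebraMap ℝ ℂ) *ᵥ v) i).im) = A *ᵥ fun i => (v i).im := by
  ext i
  simp [mulVec, dotProduct]

theorem Matrix.NegDef.dotProduct_mulVec_lt {ι : Type*} [Fintype ι] {A X : Matrix ι ι ℝ}
    (h : (Aᵀ * X * A - X).NegDef) {x : ι → ℝ} (hx : x ≠ 0) :
    (A *ᵥ x) ⬝ᵥ (X *ᵥ (A *ᵥ x)) < x ⬝ᵥ (X *ᵥ x) := by
  have hpos := PosDef.dotProduct_mulVec_pos h hx
  have hcongr : x ⬝ᵥ ((Aᵀ * X * A) *ᵥ x) = (A *ᵥ x) ⬝ᵥ (X *ᵥ (A *ᵥ x)) := by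
    rw [← mulVec_mulVec, ← mulVec_mulVec, dotProduct_mulVec, vecMul_transpose]
  rw [star_trivial, neg_mulVec, dotProduct_neg, sub_mulVec, dotProduct_sub, hcongr] at hpos
  linarith

theorem Matrix.dotProduct_mulVec_rotation {ι : Type*} [Fintype ι] (X : Matrix ι ι ℝ)
    (a b : ι → ℝ) (s t : ℝ) :
    (s • a - t • b) ⬝ᵥ (X *ᵥ (s • a - t • b)) + (s • b + t • a) ⬝ᵥ (X *ᵥ (s • b + t • a)) =
      (s ^ 2 + t ^ 2) * (a ⬝ᵥ (X *ᵥ a) + b ⬝ᵥ (X *ᵥ b)) := by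
  simp only [mulVec_sub, mulVec_add, mulVec_smul, dotProduct_sub, sub_dotProduct, dotProduct_add,
    add_dotProduct, dotProduct_smul, smul_dotProduct, smul_eq_mul]
  ring

/-- **Discrete-time Lyapunov stability**: if `X ≻ 0` is symmetric and
`AᵀXA − X ≺ 0`, then every complex eigenvalue of `A` has modulus `< 1`. -/
theorem discrete_lyapunov_stability {n : ℕ} (A X : Matrix (Fin n) (Fin n) ℝ)
    (hX : X.PosDef) (hLyap : (Aᵀ * X * A - X).NegDef) :
    ∀ μ : ℂ, μ ∈ spectrum ℂ (A.map (algebraMap ℝ ℂ)) → ‖μ‖ < 1 := by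
  intro μ hμ
  obtain ⟨v, hv, hAv⟩ := exists_mulVec_eq_smul_of_mem_spectrum hμ
  have hre := re_map_mulVec A v
  have him := im_map_mulVec A v
  rw [hAv] at hre him
  set a : Fin n → ℝ := fun i => (v i).re with ha
  set b : Fin n → ℝ := fun i => (v i).im with hb
  have hAa : A *ᵥ a = μ.re • a - μ.im • b := by
    rw [← hre]
    ext i
    simp [ha, hb]
  have hAb : A *ᵥ b = μ.re • b + μ.im • a := by
    rw [← him]
    ext i
    simp [ha, hb]
  have hab : a ≠ 0 ∨ b ≠ 0 := by
    by_contra! h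
    exact hv (funext fun i => Complex.ext (congrFun h.1 i) (congrFun h.2 i))
  have hnonneg (x : Fin n → ℝ) : 0 ≤ x ⬝ᵥ (X *ᵥ x) := by
    simpa using hX.posSemidef.dotProduct_mulVec_nonneg x
  have hle (x : Fin n → ℝ) : (A *ᵥ x) ⬝ᵥ (X *ᵥ (A *ᵥ x)) ≤ x ⬝ᵥ (X *ᵥ x) := by
    rcases eq_or_ne x 0 with rfl | hx
    · simp
    · exact (hLyap.dotProduct_mulVec_lt hx).le
  have hlt : (A *ᵥ a) ⬝ᵥ (X *ᵥ (A *ᵥ a)) + (A *ᵥ b) ⬝ᵥ (X *ᵥ (A *ᵥ b)) <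
      a ⬝ᵥ (X *ᵥ a) + b ⬝ᵥ (X *ᵥ b) := by
    rcases hab with h | h
    · exact add_lt_add_of_lt_of_le (hLyap.dotProduct_mulVec_lt h) (hle b)
    · exact add_lt_add_of_le_of_lt (hle a) (hLyap.dotProduct_mulVec_lt h)
  rw [hAa, hAb, dotProduct_mulVec_rotation] at hlt
  have hsq : ‖μ‖ ^ 2 = μ.re ^ 2 + μ.im ^ 2 := by
    rw [Complex.sq_norm, Complex.normSq_apply]
    ring
  rw [← hsq] at hlt
  by_contra! h
  nlinarith [mul_le_mul_of_nonneg_right (one_le_pow₀ h : 1 ≤ ‖μ‖ ^ 2)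
    (add_nonneg (hnonneg a) (hnonneg b))]
end

section
/- Let A ∈ ℝ^{n×n}, B ∈ ℝ^{n×m}, C ∈ ℝ^{p×n}, D ∈ ℝ^{p×m}, γ > 0, and let X ∈ ℝ^{n×n} be symmetric positive definite with AᵀXA − X + CᵀC negative definite and trace(BᵀXB + DᵀD) < γ². Then every eigenvalue of A has modulus less than 1, so e^{iω}I − A is invertible for all ω ∈ ℝ and the transfer function T(e^{iω}) = C(e^{iω}I − A)^{-1}B + D is well-defined, and (1/(2π)) ∫_{−π}^{π} trace(T(e^{iω})^* T(e^{iω})) dω < γ². -/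
open Matrix

section ComplexSteinInequality

variable {n m p : Type*} [Fintype n] [Fintype m] [Fintype p]

open scoped ComplexOrder

open scoped MatrixOrder in
/-- A real positive definite matrix is positive definite as a complex matrix. -/
theorem Matrix.PosDef.map_complex [DecidableEq n] {X : Matrix n n ℝ} (hX : X.PosDef) :
    (X.map (algebraMap ℝ ℂ)).PosDef := by
  obtain ⟨S, hS⟩ := CStarAlgebra.nonneg_iff_eq_star_mul_self.mp hX.posSemidef.nonneg
  have hmap : X.map (algebraMap ℝ ℂ) =
      (S.map (algebraMap ℝ ℂ))ᴴ * S.map (algebraMap ℝ ℂ) := by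
    rw [hS, Matrix.map_mul, star_eq_conjTranspose, conjTranspose_map]
    intro x
    simp
  have hpsd : (X.map (algebraMap ℝ ℂ)).PosSemidef := by
    rw [hmap]
    exact posSemidef_conjTranspose_mul_self _
  rw [hpsd.posDef_iff_isUnit]
  exact hX.isUnit.map (algebraMap ℝ ℂ).mapMatrix

/-- A strict Stein inequality forces the spectrum into the open unit disc. -/
theorem norm_lt_one_of_mem_spectrum_of_stein [DecidableEq n] {A X : Matrix n n ℂ}
    {C : Matrix p n ℂ} (hX : X.PosDef) (hQ : (X - Aᴴ * X * A - Cᴴ * C).PosDef)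
    {μ : ℂ} (hμ : μ ∈ spectrum ℂ A) : ‖μ‖ < 1 := by
  rw [← spectrum_toLin', ← Module.End.hasEigenvalue_iff_mem_spectrum] at hμ
  obtain ⟨v, hv⟩ := hμ.exists_hasEigenvector
  have hAv : A *ᵥ v = μ • v := by simpa using hv.apply_eq_smul
  have h1 := hX.re_dotProduct_pos hv.2
  have h2 := hQ.re_dotProduct_pos hv.2
  have h3 := (posSemidef_conjTranspose_mul_self C).re_dotProduct_nonneg v
  have h4 : star v ⬝ᵥ ((Aᴴ * X * A) *ᵥ v) = (‖μ‖ ^ 2 : ℝ) * (star v ⬝ᵥ (X *ᵥ v)) := by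
    rw [← mulVec_mulVec, ← mulVec_mulVec, dotProduct_mulVec, ← star_mulVec, hAv, mulVec_smul,
      star_smul, smul_dotProduct, dotProduct_smul, smul_eq_mul, smul_eq_mul, ← mul_assoc,
      ← Complex.normSq_eq_norm_sq, Complex.normSq_eq_conj_mul_self]
    rfl
  rw [sub_mulVec, sub_mulVec, dotProduct_sub, dotProduct_sub, h4] at h2
  simp only [RCLike.re_to_complex, Complex.sub_re, Complex.re_ofReal_mul] at h1 h2 h3
  by_contra! h
  nlinarith [mul_nonneg (sub_nonneg.2 (one_le_pow₀ h : 1 ≤ ‖μ‖ ^ 2)) h1.le]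

/-- The completion-of-squares bound for the response `V` of `z V = A V + B` on the unit circle. -/
theorem re_trace_response_le {A X : Matrix n n ℂ} {B V : Matrix n m ℂ}
    {C : Matrix p n ℂ} {D : Matrix p m ℂ} (hX : X.IsHermitian)
    (hQ : (X - Aᴴ * X * A - Cᴴ * C).PosSemidef) {z : ℂ} (hz : ‖z‖ = 1)
    (hV : z • V = A * V + B) :
    (trace ((C * V + D)ᴴ * (C * V + D))).re ≤
      2 * (trace ((Bᴴ * X * A + Dᴴ * C) * V)).re + (trace (Bᴴ * X * B + Dᴴ * D)).re := by
  have hW : (A * V + B)ᴴ * X * (A * V + B) = Vᴴ * X * V := by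
    rw [← hV, conjTranspose_smul, Matrix.smul_mul, Matrix.smul_mul, Matrix.mul_smul, smul_smul]
    have : star z * z = 1 := by
      rw [Complex.star_def, Complex.conj_mul', hz]
      simp
    rw [this, one_smul]
  have key : (C * V + D)ᴴ * (C * V + D) + Vᴴ * (X - Aᴴ * X * A - Cᴴ * C) * V =
      (Bᴴ * X * A + Dᴴ * C) * V + ((Bᴴ * X * A + Dᴴ * C) * V)ᴴ + (Bᴴ * X * B + Dᴴ * D) := by
    rw [Matrix.mul_sub, Matrix.mul_sub, Matrix.sub_mul, Matrix.sub_mul, ← hW]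
    simp only [conjTranspose_add, conjTranspose_mul, conjTranspose_conjTranspose, hX.eq,
      Matrix.mul_add, Matrix.add_mul, Matrix.mul_assoc]
    abel
  have hnonneg := (Complex.le_def.mp (hQ.conjTranspose_mul_mul_same V).trace_nonneg).1
  have htr := congrArg (fun M => (trace M).re) key
  simp only [trace_add, trace_conjTranspose, Complex.add_re, Complex.star_def,
    Complex.conj_re, Complex.zero_re] at htr hnonneg ⊢
  linarith

end ComplexSteinInequality

section Resolvent

variable {n : Type*} [Fintype n] [DecidableEq n]

theorem isUnit_one_sub_smul_of_spectrum {A : Matrix n n ℂ}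
    (hA : ∀ μ ∈ spectrum ℂ A, ‖μ‖ < 1) {w : ℂ} (hw : ‖w‖ ≤ 1) : IsUnit (1 - w • A) := by
  rcases eq_or_ne w 0 with rfl | hw0
  · simp
  have hmem : w⁻¹ ∉ spectrum ℂ A := fun h => by
    have h1 := hA _ h
    rw [norm_inv] at h1
    exact absurd h1 (not_lt.2 ((one_le_inv₀ (norm_pos_iff.2 hw0)).2 hw))
  rw [spectrum.notMem_iff, Algebra.algebraMap_eq_smul_one] at hmem
  have h2 := hmem.smul (Units.mk0 w hw0)
  simpa [Units.smul_def, smul_sub, smul_smul, hw0] using h2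

theorem isUnit_smul_one_sub_of_spectrum {A : Matrix n n ℂ}
    (hA : ∀ μ ∈ spectrum ℂ A, ‖μ‖ < 1) {z : ℂ} (hz : ‖z‖ = 1) :
    IsUnit (z • (1 : Matrix n n ℂ) - A) := by
  have hmem : z ∉ spectrum ℂ A := fun h => (hA z h).ne hz
  rwa [spectrum.notMem_iff, Algebra.algebraMap_eq_smul_one] at hmem

open scoped Matrix.Norms.Operator in
theorem differentiableAt_trace_mul_inv (A M : Matrix n n ℂ) {w : ℂ}
    (hw : IsUnit (1 - w • A)) :
    DifferentiableAt ℂ (fun w : ℂ => trace (M * (1 - w • A)⁻¹)) w := by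
  simp only [nonsing_inv_eq_ringInverse]
  have h1 : DifferentiableAt ℂ (fun w : ℂ => Ring.inverse (1 - w • A)) w :=
    DifferentiableAt.inverse (by fun_prop) hw
  have h2 : Differentiable ℂ (fun N : Matrix n n ℂ => trace (M * N)) :=
    ((traceLinearMap n ℂ ℂ).comp (LinearMap.mulLeft ℂ M)).toContinuousLinearMap.differentiable
  exact h2.differentiableAt.comp w h1

open scoped Matrix.Norms.Operator in
theorem continuous_inv_exp_smul_sub {A : Matrix n n ℂ} (hA : ∀ μ ∈ spectrum ℂ A, ‖μ‖ < 1) :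
    Continuous fun ω : ℝ => (Complex.exp (ω * Complex.I) • (1 : Matrix n n ℂ) - A)⁻¹ := by
  simp only [nonsing_inv_eq_ringInverse]
  rw [continuous_iff_continuousAt]
  intro ω
  have hu := isUnit_smul_one_sub_of_spectrum hA (Complex.norm_exp_ofReal_mul_I ω)
  exact ContinuousAt.comp (f := fun ω : ℝ => Complex.exp (ω * Complex.I) • (1 : Matrix n n ℂ) - A)
    (differentiableAt_inverse (𝕜 := ℂ) hu).continuousAt (by fun_prop)

/-- The zeroth Fourier coefficient of the resolvent of a Schur stable matrix vanishes. -/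
theorem integral_trace_mul_resolvent_eq_zero {A : Matrix n n ℂ}
    (hA : ∀ μ ∈ spectrum ℂ A, ‖μ‖ < 1) (M : Matrix n n ℂ) :
    ∫ ω in (-Real.pi)..Real.pi,
      trace (M * (Complex.exp (ω * Complex.I) • (1 : Matrix n n ℂ) - A)⁻¹) = 0 := by
  set g : ℂ → ℂ := fun w => w * trace (M * (1 - w • A)⁻¹) with hg
  have hgd : ∀ w : ℂ, ‖w‖ ≤ 1 → DifferentiableAt ℂ g w := fun w hw =>
    differentiableAt_id.mul
      (differentiableAt_trace_mul_inv A M (isUnit_one_sub_smul_of_spectrum hA hw))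
  have havg : Real.circleAverage g 0 1 = 0 := by
    have h := circleAverage_of_differentiable_on_off_countable (f := g) (c := 0) (R := 1)
      Set.countable_empty
      (fun w hw => (hgd w (by simpa using hw)).continuousAt.continuousWithinAt)
      (fun w hw => hgd w (by simpa using (Metric.ball_subset_closedBall hw.1)))
    simpa [hg] using h
  rw [Real.circleAverage_def, smul_eq_zero, or_iff_right (by positivity)] at havg
  have hper : Function.Periodic (fun θ : ℝ => g (circleMap 0 1 θ)) (2 * Real.pi) := fun θ => by
    simp only [periodic_circleMap 0 1 θ]
  have hshift := hper.intervalIntegral_add_eq (-Real.pi) 0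
  rw [zero_add, havg, show -Real.pi + 2 * Real.pi = Real.pi by ring] at hshift
  rw [← hshift]
  have hneg := intervalIntegral.integral_comp_neg (a := -Real.pi) (b := Real.pi)
    (fun θ : ℝ => g (circleMap 0 1 θ))
  rw [neg_neg] at hneg
  rw [← hneg]
  refine intervalIntegral.integral_congr fun ω _ => ?_
  have hw : circleMap 0 1 (-ω) = (Complex.exp (ω * Complex.I))⁻¹ := by
    simp [circleMap, ← Complex.exp_neg]
  have hz0 := Complex.exp_ne_zero (ω * Complex.I)
  have hzn := Complex.norm_exp_ofReal_mul_I ω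
  simp only [hg, hw]
  generalize Complex.exp (ω * Complex.I) = z at hz0 hzn
  have hu := isUnit_one_sub_smul_of_spectrum hA (w := z⁻¹) (by simp [hzn])
  have hfac : z • (1 : Matrix n n ℂ) - A = z • (1 - z⁻¹ • A) := by
    simp [smul_sub, smul_smul, hz0]
  have hinv : (z • (1 : Matrix n n ℂ) - A)⁻¹ = z⁻¹ • (1 - z⁻¹ • A)⁻¹ := by
    apply inv_eq_right_inv
    rw [hfac, Matrix.smul_mul, Matrix.mul_smul, smul_smul, mul_inv_cancel₀ hz0, one_smul]
    exact mul_nonsing_inv _ ((isUnit_iff_isUnit_det _).1 hu)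
  rw [hinv, Matrix.mul_smul, trace_smul, smul_eq_mul]

end Resolvent

open scoped ComplexOrder in
/-- A Stein inequality bounds the squared `H2` norm over the unit circle. -/
theorem integral_re_trace_transfer_le {n m p : Type*} [Fintype n] [DecidableEq n] [Fintype m]
    [Fintype p] {A X : Matrix n n ℂ} {B : Matrix n m ℂ} {C : Matrix p n ℂ} {D : Matrix p m ℂ}
    (hA : ∀ μ ∈ spectrum ℂ A, ‖μ‖ < 1) (hX : X.IsHermitian)
    (hQ : (X - Aᴴ * X * A - Cᴴ * C).PosSemidef) :
    ∫ ω in (-Real.pi)..Real.pi,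
      (trace ((C * (Complex.exp (ω * Complex.I) • (1 : Matrix n n ℂ) - A)⁻¹ * B + D)ᴴ *
        (C * (Complex.exp (ω * Complex.I) • (1 : Matrix n n ℂ) - A)⁻¹ * B + D))).re ≤
      2 * Real.pi * (trace (Bᴴ * X * B + Dᴴ * D)).re := by
  have hR := continuous_inv_exp_smul_sub hA
  set M := B * (Bᴴ * X * A + Dᴴ * C)
  have hint : IntervalIntegrable (fun ω : ℝ =>
      trace (M * (Complex.exp (ω * Complex.I) • (1 : Matrix n n ℂ) - A)⁻¹))
      MeasureTheory.volume (-Real.pi) Real.pi :=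
    (continuous_const.matrix_mul hR).matrix_trace.intervalIntegrable _ _
  have hzero : ∫ ω in (-Real.pi)..Real.pi,
      (trace (M * (Complex.exp (ω * Complex.I) • (1 : Matrix n n ℂ) - A)⁻¹)).re = 0 := by
    have h := Complex.reCLM.intervalIntegral_comp_comm hint
    rw [integral_trace_mul_resolvent_eq_zero hA M] at h
    simpa using h
  have hre : Continuous fun ω : ℝ =>
      (trace (M * (Complex.exp (ω * Complex.I) • (1 : Matrix n n ℂ) - A)⁻¹)).re :=
    Complex.continuous_re.comp (continuous_const.matrix_mul hR).matrix_trace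
  have hT : Continuous fun ω : ℝ =>
      C * (Complex.exp (ω * Complex.I) • (1 : Matrix n n ℂ) - A)⁻¹ * B + D :=
    ((continuous_const.matrix_mul hR).matrix_mul continuous_const).add continuous_const
  calc _ ≤ ∫ ω in (-Real.pi)..Real.pi,
        (2 * (trace (M * (Complex.exp (ω * Complex.I) • (1 : Matrix n n ℂ) - A)⁻¹)).re +
          (trace (Bᴴ * X * B + Dᴴ * D)).re) := by
        refine intervalIntegral.integral_mono_on (by linarith [Real.pi_pos])
          ((Complex.continuous_re.comp
            (hT.matrix_conjTranspose.matrix_mul hT).matrix_trace).intervalIntegrable _ _)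
          (((continuous_const.mul hre).add continuous_const).intervalIntegrable _ _)
          fun ω _ => ?_
        have hz := Complex.norm_exp_ofReal_mul_I ω
        have hu := (isUnit_iff_isUnit_det _).1 (isUnit_smul_one_sub_of_spectrum hA hz)
        generalize Complex.exp (ω * Complex.I) = z at hz hu
        set R := (z • (1 : Matrix n n ℂ) - A)⁻¹
        have hV : z • (R * B) = A * (R * B) + B := by
          have h := congrArg (· * B) (mul_nonsing_inv _ hu)
          simp only [Matrix.sub_mul, Matrix.smul_mul, Matrix.one_mul, Matrix.mul_assoc] at h
          exact sub_eq_iff_eq_add'.1 h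
        have h := re_trace_response_le (D := D) hX hQ hz hV
        rwa [← Matrix.mul_assoc, ← Matrix.mul_assoc, trace_mul_comm _ B, ← Matrix.mul_assoc] at h
    _ = 2 * Real.pi * (trace (Bᴴ * X * B + Dᴴ * D)).re := by
        rw [intervalIntegral.integral_add ((hre.const_mul 2).intervalIntegrable _ _)
          (continuous_const.intervalIntegrable _ _), intervalIntegral.integral_const_mul, hzero,
          intervalIntegral.integral_const, smul_eq_mul]
        ring

/-- **Discrete-time H2 performance from a Lyapunov certificate**: if `X ≻ 0`,
`AᵀXA − X + CᵀC ≺ 0` and `trace(BᵀXB + DᵀD) < γ²`, then `A` has all eigenvalues in the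
open unit disc, `e^{iω}I − A` is invertible for all `ω`, and the squared H2 norm
`(1/2π) ∫_{−π}^{π} trace(T(e^{iω})^* T(e^{iω})) dω` is `< γ²`, where
`T(z) = C(zI − A)⁻¹B + D`. -/
theorem h2_norm_bound {nn mm pp : ℕ}
    (A : Matrix (Fin nn) (Fin nn) ℝ) (B : Matrix (Fin nn) (Fin mm) ℝ)
    (C : Matrix (Fin pp) (Fin nn) ℝ) (D : Matrix (Fin pp) (Fin mm) ℝ)
    (γ : ℝ) (hγ : 0 < γ)
    (X : Matrix (Fin nn) (Fin nn) ℝ) (hX : X.PosDef)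
    (hLyap : (Aᵀ * X * A - X + Cᵀ * C).NegDef)
    (htrace : Matrix.trace (Bᵀ * X * B + Dᵀ * D) < γ ^ 2) :
    (∀ μ : ℂ, μ ∈ spectrum ℂ (A.map (algebraMap ℝ ℂ)) → ‖μ‖ < 1) ∧
    (∀ ω : ℝ, IsUnit
      (Complex.exp (ω * Complex.I) • (1 : Matrix (Fin nn) (Fin nn) ℂ) -
        A.map (algebraMap ℝ ℂ))) ∧
    (1 / (2 * Real.pi)) *
        (∫ ω in (-Real.pi)..Real.pi,
          (Matrix.trace
            ((C.map (algebraMap ℝ ℂ) *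
                (Complex.exp (ω * Complex.I) • (1 : Matrix (Fin nn) (Fin nn) ℂ) -
                  A.map (algebraMap ℝ ℂ))⁻¹ * B.map (algebraMap ℝ ℂ) +
              D.map (algebraMap ℝ ℂ))ᴴ *
            (C.map (algebraMap ℝ ℂ) *
                (Complex.exp (ω * Complex.I) • (1 : Matrix (Fin nn) (Fin nn) ℂ) -
                  A.map (algebraMap ℝ ℂ))⁻¹ * B.map (algebraMap ℝ ℂ) +
              D.map (algebraMap ℝ ℂ)))).re) < γ ^ 2 := by
  have hconj : ∀ {k l : ℕ} (M : Matrix (Fin k) (Fin l) ℝ),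
      (M.map (algebraMap ℝ ℂ))ᴴ = Mᵀ.map (algebraMap ℝ ℂ) := fun M => by
    ext i j
    simp
  have hQ := Matrix.PosDef.map_complex hLyap
  rw [show -(Aᵀ * X * A - X + Cᵀ * C) = X - Aᵀ * X * A - Cᵀ * C by abel,
    Matrix.map_sub _ (map_sub _), Matrix.map_sub _ (map_sub _), Matrix.map_mul, Matrix.map_mul,
    Matrix.map_mul, ← hconj, ← hconj] at hQ
  have hXc := hX.map_complex
  have hspec : ∀ μ ∈ spectrum ℂ (A.map (algebraMap ℝ ℂ)), ‖μ‖ < 1 := fun μ hμ =>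
    norm_lt_one_of_mem_spectrum_of_stein hXc hQ hμ
  refine ⟨hspec, fun ω => isUnit_smul_one_sub_of_spectrum hspec
    (Complex.norm_exp_ofReal_mul_I ω), ?_⟩
  have hbound := integral_re_trace_transfer_le (B := B.map (algebraMap ℝ ℂ))
    (D := D.map (algebraMap ℝ ℂ)) hspec (open scoped ComplexOrder in hXc.isHermitian) (open scoped ComplexOrder in hQ.posSemidef)
  have htr : (trace ((B.map (algebraMap ℝ ℂ))ᴴ * X.map (algebraMap ℝ ℂ) * B.map (algebraMap ℝ ℂ) +
      (D.map (algebraMap ℝ ℂ))ᴴ * D.map (algebraMap ℝ ℂ))).re =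
      trace (Bᵀ * X * B + Dᵀ * D) := by
    rw [hconj, hconj, ← Matrix.map_mul, ← Matrix.map_mul, ← Matrix.map_mul,
      ← Matrix.map_add _ (map_add _), ← AddMonoidHom.map_trace]
    simp
  rw [htr] at hbound
  rw [one_div, inv_mul_lt_iff₀ (by positivity)]
  exact hbound.trans_lt (mul_lt_mul_of_pos_left htrace (by positivity))
end

section
/- Let X, Y ∈ ℝ^{k×k} be symmetric matrices such that the 2k×2k block matrix [[X, I],[I, Y]] is positive definite. Then there exists a symmetric positive definite matrix X^K ∈ ℝ^{2k×2k} whose upper-left k×k block equals X and such that the upper-left k×k block of (X^K)^{-1} equals Y. -/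
open Matrix

/-- **Storage-function completion** (coupling condition): if `X, Y` are symmetric with
`[[X, I],[I, Y]] ≻ 0`, then there is a symmetric positive definite `X^K ∈ ℝ^{2k×2k}`
whose upper-left block is `X` and whose inverse has upper-left block `Y`. -/
theorem storage_completion {k : ℕ} (X Y : Matrix (Fin k) (Fin k) ℝ)
    (hX : X.IsSymm) (hY : Y.IsSymm)
    (hcouple : (Matrix.fromBlocks X (1 : Matrix (Fin k) (Fin k) ℝ)
      (1 : Matrix (Fin k) (Fin k) ℝ) Y).PosDef) :
    ∃ XK : Matrix (Fin k ⊕ Fin k) (Fin k ⊕ Fin k) ℝ,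
      XK.PosDef ∧ XK.toBlocks₁₁ = X ∧ (XK⁻¹).toBlocks₁₁ = Y := by
  have hYpos : Y.PosDef := hcouple.submatrix Sum.inr_injective
  have hYdet : IsUnit Y.det := hYpos.det_pos.ne'.isUnit
  have hYl : Y⁻¹ * Y = 1 := nonsing_inv_mul Y hYdet
  have hYr : Y * Y⁻¹ = 1 := mul_nonsing_inv Y hYdet
  have hYt : (Y⁻¹)ᵀ = Y⁻¹ := by rw [transpose_nonsing_inv, hY.eq]
  -- `[[X, S], [S, S]]` with `S = X - Y⁻¹` is congruent to the coupling matrix via `N`.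
  let N := fromBlocks (1 : Matrix (Fin k) (Fin k) ℝ) 1 0 (-Y⁻¹)
  have hN : Function.Injective N.mulVec := by
    refine mulVec_injective_of_isUnit (IsUnit.of_mul_eq_one (fromBlocks 1 Y 0 (-Y)) ?_)
    simp [N, fromBlocks_multiply, hYl, ← fromBlocks_one]
  have hXK : (fromBlocks X (X - Y⁻¹) (X - Y⁻¹) (X - Y⁻¹)).PosDef := by
    convert hcouple.conjTranspose_mul_mul_same hN using 1
    simp [N, fromBlocks_transpose, fromBlocks_multiply, conjTranspose_eq_transpose_of_trivial,
      hYt, add_mul, mul_assoc, hYr, sub_eq_add_neg]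
  have hS : (X - Y⁻¹).PosDef := hXK.submatrix Sum.inr_injective
  refine ⟨_, hXK, toBlocks_fromBlocks₁₁ .., ?_⟩
  rw [inv_eq_right_inv (B := fromBlocks Y (-Y) (-Y) (Y + (X - Y⁻¹)⁻¹)), toBlocks_fromBlocks₁₁]
  have hSr : (X - Y⁻¹) * (X - Y⁻¹)⁻¹ = 1 := mul_nonsing_inv _ hS.det_pos.ne'.isUnit
  rw [fromBlocks_multiply, ← fromBlocks_one]
  simp only [mul_add, hSr, mul_neg, sub_mul, hYl]
  congr 1 <;> abel
end

section
/- Let X, Y ∈ ℝ^{k×k} be symmetric with [[X, I],[I, Y]] positive definite, and let M, N ∈ ℝ^{k×k} be nonsingular matrices with M Nᵀ = I − XY. Then the 2k×2k block matrix [[Y, I],[Nᵀ, 0]] is invertible; the equation X^K · [[Y, I],[Nᵀ, 0]] = [[I, X],[0, Mᵀ]] has a unique solution X^K ∈ ℝ^{2k×2k}; and this X^K is symmetric positive definite, its upper-left k×k block equals X, and the upper-left k×k block of (X^K)^{-1} equals Y. -/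
open Matrix

/-- **Step (1) of the controller construction algorithm**: for symmetric `X, Y` with
`[[X, I],[I, Y]] ≻ 0` and nonsingular `M, N` with `M Nᵀ = I − X Y`, the block matrix
`[[Y, I],[Nᵀ, 0]]` is invertible, the linear equation
`X^K [[Y, I],[Nᵀ, 0]] = [[I, X],[0, Mᵀ]]` has a unique solution `X^K`, and this solution is
symmetric positive definite with upper-left block `X`, and `(X^K)⁻¹` has upper-left block `Y`. -/
theorem controller_construction_step1 {k : ℕ} (X Y M N : Matrix (Fin k) (Fin k) ℝ)
    (hX : X.IsSymm) (hY : Y.IsSymm)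
    (hcouple : (Matrix.fromBlocks X (1 : Matrix (Fin k) (Fin k) ℝ)
      (1 : Matrix (Fin k) (Fin k) ℝ) Y).PosDef)
    (hM : IsUnit M) (hN : IsUnit N)
    (hMN : M * Nᵀ = 1 - X * Y) :
    IsUnit (Matrix.fromBlocks Y (1 : Matrix (Fin k) (Fin k) ℝ) Nᵀ 0) ∧
    (∃! XK : Matrix (Fin k ⊕ Fin k) (Fin k ⊕ Fin k) ℝ,
        XK * Matrix.fromBlocks Y (1 : Matrix (Fin k) (Fin k) ℝ) Nᵀ 0 =
          Matrix.fromBlocks (1 : Matrix (Fin k) (Fin k) ℝ) X 0 Mᵀ) ∧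
    (∀ XK : Matrix (Fin k ⊕ Fin k) (Fin k ⊕ Fin k) ℝ,
        XK * Matrix.fromBlocks Y (1 : Matrix (Fin k) (Fin k) ℝ) Nᵀ 0 =
          Matrix.fromBlocks (1 : Matrix (Fin k) (Fin k) ℝ) X 0 Mᵀ →
        XK.PosDef ∧ XK.toBlocks₁₁ = X ∧ (XK⁻¹).toBlocks₁₁ = Y) := by
  have hNu : IsUnit Nᵀ := (isUnit_transpose N).2 hN
  have hW : IsUnit (fromBlocks Y (1 : Matrix (Fin k) (Fin k) ℝ) Nᵀ 0) := by
    refine IsUnit.of_mul_eq_one (fromBlocks 0 (Nᵀ)⁻¹ 1 (-(Y * (Nᵀ)⁻¹))) ?_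
    rw [fromBlocks_multiply, ← fromBlocks_one]
    simp [mul_nonsing_inv _ ((isUnit_iff_isUnit_det _).1 hNu)]
  refine ⟨hW, ?_, fun XK h => ?_⟩
  · have hdet := (isUnit_iff_isUnit_det _).1 hW
    refine ⟨fromBlocks 1 X 0 Mᵀ * (fromBlocks Y 1 Nᵀ 0)⁻¹,
      nonsing_inv_mul_cancel_right _ _ hdet, fun Z hZ => ?_⟩
    rw [← hZ, mul_nonsing_inv_cancel_right _ _ hdet]
  · have hNM : Y * X + N * Mᵀ = 1 := by
      have ht := congrArg transpose hMN
      simp only [transpose_mul, transpose_transpose, transpose_sub, transpose_one, hX.eq,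
        hY.eq] at ht
      rw [ht, add_sub_cancel]
    have hcongr : star (fromBlocks Y (1 : Matrix (Fin k) (Fin k) ℝ) Nᵀ 0) * XK *
        fromBlocks Y 1 Nᵀ 0 = fromBlocks Y 1 1 X := by
      rw [mul_assoc, h, star_eq_conjTranspose, fromBlocks_conjTranspose, fromBlocks_multiply]
      simp [conjTranspose_eq_transpose_of_trivial, hY.eq, hNM]
    have hpos : XK.PosDef := by
      rw [← IsUnit.posDef_star_left_conjugate_iff hW, hcongr]
      simpa using hcouple.submatrix (e := Sum.swap) Sum.swap_leftInverse.injective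
    refine ⟨hpos, ?_, ?_⟩
    · have h₁₂ := congrArg toBlocks₁₂ h
      rw [← fromBlocks_toBlocks XK, fromBlocks_multiply] at h₁₂
      simpa using h₁₂
    · have hinv := congrArg (XK⁻¹ * ·) h
      simp only [nonsing_inv_mul_cancel_left _ _ ((isUnit_iff_isUnit_det _).1 hpos.isUnit)] at hinv
      rw [← fromBlocks_toBlocks XK⁻¹, fromBlocks_multiply] at hinv
      simpa using (congrArg toBlocks₁₁ hinv).symm
end
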